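/- Let Λ = KQ/I be a simple gluing algebra of bound quiver algebras A = KQ_A/I_A and B = KQ_B/I_B, obtained by identifying vertices a ∈ Q_A and b ∈ Q_B into a glued vertex v, with I = ⟨I_A, I_B⟩. Then Λ is finite-dimensional if and only if every non-trivial path in Q_A from a to a lies in I_A, or every non-trivial path in Q_B from b to b lies in I_B. -/

import Mathlib

set_option maxHeartbeats 1000000
set_option synthInstance.maxHeartbeats 400000

open CategoryTheory


/-- A finite quiver: finite sets of vertices and of arrows, with source and target maps. -/
structure BQuiver : Type 1 where
  V : Type
  Arr : Type
  fV : Fintype V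
  dV : DecidableEq V
  fA : Fintype Arr
  s : Arr → V
  t : Arr → V

attribute [instance] BQuiver.fV BQuiver.dV BQuiver.fA

instance BQuiver.quiver (Q : BQuiver) : Quiver Q.V :=
  ⟨fun i j => {e : Q.Arr // Q.s e = i ∧ Q.t e = j}⟩

/-- The index set of paths of a quiver. -/
def PIdx (Q : BQuiver) : Type := Σ i j : Q.V, Quiver.Path i j

/-- The underlying vector space of the path algebra: the free `K`-module on the set of paths. -/
def PMod (K : Type) [Field K] (Q : BQuiver) : Type := PIdx Q →₀ K

noncomputable instance (K : Type) [Field K] (Q : BQuiver) : AddCommGroup (PMod K Q) :=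
  inferInstanceAs (AddCommGroup (PIdx Q →₀ K))

noncomputable instance (K : Type) [Field K] (Q : BQuiver) : Module K (PMod K Q) :=
  inferInstanceAs (Module K (PIdx Q →₀ K))

/-- The operator of left multiplication by a path `p`, acting on the free module on paths:
a basis path `q` is sent to the concatenation `q.comp p` when composable and to `0`
otherwise. -/
noncomputable def Lop (K : Type) [Field K] (Q : BQuiver) {i j : Q.V} (p : Quiver.Path i j) :
    Module.End K (PMod K Q) :=
  Finsupp.lsum K fun q : PIdx Q =>
    if h : q.2.1 = i then Finsupp.lsingle (⟨q.1, j, (h ▸ q.2.2).comp p⟩ : PIdx Q) else 0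

/-- The path algebra `KQ`, realized via the faithful left regular representation as the
subalgebra of `End_K(K^{(paths)})` generated by the left multiplication operators by paths. -/
noncomputable def PathAlg (K : Type) [Field K] (Q : BQuiver) :
    Subalgebra K (Module.End K (PMod K Q)) :=
  Algebra.adjoin K {f | ∃ (i j : Q.V) (p : Quiver.Path i j), f = Lop K Q p}

/-- The element of the path algebra corresponding to a path. -/
noncomputable def pathEl (K : Type) [Field K] (Q : BQuiver) {i j : Q.V}
    (p : Quiver.Path i j) : PathAlg K Q :=
  ⟨Lop K Q p, Algebra.subset_adjoin ⟨i, j, p, rfl⟩⟩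
/-- Evaluation of a formal linear combination of paths as an endomorphism. -/
noncomputable def evalEnd (K : Type) [Field K] (Q : BQuiver) : (PIdx Q →₀ K) →ₗ[K] Module.End K (PMod K Q) :=
  Finsupp.lsum K fun q : PIdx Q => LinearMap.toSpanSingleton K _ (Lop K Q q.2.2)

/-- Evaluation of a formal linear combination of paths as an element of the path algebra. -/
noncomputable def evalPA (K : Type) [Field K] (Q : BQuiver) (x : PIdx Q →₀ K) : PathAlg K Q :=
  ⟨evalEnd K Q x, by
    classical
    have : evalEnd K Q x = ∑ q ∈ x.support, x q • Lop K Q q.2.2 := by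
      simp [evalEnd, Finsupp.lsum_apply, Finsupp.sum, LinearMap.toSpanSingleton_apply]
    rw [this]
    exact Submodule.sum_mem (Subalgebra.toSubmodule (PathAlg K Q)) fun q _ =>
      Submodule.smul_mem _ _ (Algebra.subset_adjoin ⟨q.1, q.2.1, q.2.2, rfl⟩)⟩
section Glue

variable (QA QB : BQuiver) (a : QA.V) (b : QB.V)

/-- The vertex map from `Q_B` to the glued quiver: `b` is identified with `a`. -/
def vmapB : QB.V → (QA.V ⊕ {x : QB.V // x ≠ b}) := fun x =>
  if h : x = b then Sum.inl a else Sum.inr ⟨x, h⟩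

/-- The simple gluing quiver of `Q_A` and `Q_B`, obtained by identifying the vertices
`a ∈ Q_A` and `b ∈ Q_B`. -/
def glueQ : BQuiver where
  V := QA.V ⊕ {x : QB.V // x ≠ b}
  Arr := QA.Arr ⊕ QB.Arr
  fV := by infer_instance
  dV := by infer_instance
  fA := by infer_instance
  s := Sum.elim (fun e => Sum.inl (QA.s e)) (fun e => vmapB QA QB a b (QB.s e))
  t := Sum.elim (fun e => Sum.inl (QA.t e)) (fun e => vmapB QA QB a b (QB.t e))

/-- The glued vertex of the simple gluing quiver. -/
def gluedV : (glueQ QA QB a b).V := Sum.inl a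

/-- The embedding of `Q_A` into the glued quiver, as a prefunctor. -/
def embA : QA.V ⥤q (glueQ QA QB a b).V where
  obj := Sum.inl
  map := fun {i j} e => ⟨Sum.inl e.1, congrArg Sum.inl e.2.1, congrArg Sum.inl e.2.2⟩

/-- The embedding of `Q_B` into the glued quiver, as a prefunctor. -/
def embB : QB.V ⥤q (glueQ QA QB a b).V where
  obj := vmapB QA QB a b
  map := fun {i j} e => ⟨Sum.inr e.1, congrArg (vmapB QA QB a b) e.2.1,
    congrArg (vmapB QA QB a b) e.2.2⟩

variable (K : Type) [Field K]

/-- The map sending a formal linear combination of paths of `Q_A` to the corresponding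
formal linear combination of paths of the glued quiver. -/
noncomputable def liftA : (PIdx QA →₀ K) → (PIdx (glueQ QA QB a b) →₀ K) :=
  Finsupp.mapDomain fun q =>
    ⟨Sum.inl q.1, Sum.inl q.2.1, (embA QA QB a b).mapPath q.2.2⟩

/-- The map sending a formal linear combination of paths of `Q_B` to the corresponding
formal linear combination of paths of the glued quiver. -/
noncomputable def liftB : (PIdx QB →₀ K) → (PIdx (glueQ QA QB a b) →₀ K) :=
  Finsupp.mapDomain fun q =>
    ⟨vmapB QA QB a b q.1, vmapB QA QB a b q.2.1, (embB QA QB a b).mapPath q.2.2⟩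

end Glue
section Ideals

variable (K : Type) [Field K] (Q : BQuiver)

/-- The two-sided ideal of the path algebra generated by a set of relations
(formal linear combinations of paths). -/
noncomputable def relIdeal (R : Set (PIdx Q →₀ K)) : TwoSidedIdeal (PathAlg K Q) :=
  TwoSidedIdeal.span (evalPA K Q '' R)

/-- The bound quiver algebra `KQ/I`, as the quotient ring of the path algebra by a two-sided
ideal. -/
def BQAlg (I : TwoSidedIdeal (PathAlg K Q)) : Type := I.ringCon.Quotient

noncomputable instance (I : TwoSidedIdeal (PathAlg K Q)) : Ring (BQAlg K Q I) :=
  inferInstanceAs (Ring I.ringCon.Quotient)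

/-- The quotient map from the path algebra onto the bound quiver algebra. -/
noncomputable def BQmk (I : TwoSidedIdeal (PathAlg K Q)) : PathAlg K Q →+* BQAlg K Q I :=
  I.ringCon.mk'

/-- The quotient of the path algebra by (the underlying `K`-subspace of) a two-sided ideal,
as a `K`-vector space; it is `K`-linearly isomorphic to the bound quiver algebra, and is used
to express finite-dimensionality over `K`. -/
def BQAlgModK (I : TwoSidedIdeal (PathAlg K Q)) : Type :=
  (PathAlg K Q) ⧸ (Submodule.restrictScalars K (TwoSidedIdeal.asIdeal I))

noncomputable instance (I : TwoSidedIdeal (PathAlg K Q)) : AddCommGroup (BQAlgModK K Q I) :=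
  inferInstanceAs (AddCommGroup ((PathAlg K Q) ⧸ (Submodule.restrictScalars K (TwoSidedIdeal.asIdeal I))))

noncomputable instance (I : TwoSidedIdeal (PathAlg K Q)) : Module K (BQAlgModK K Q I) :=
  inferInstanceAs (Module K ((PathAlg K Q) ⧸ (Submodule.restrictScalars K (TwoSidedIdeal.asIdeal I))))

/-- An ideal of the path algebra is admissible: it contains all paths of some length `N`,
and is contained in the span of the paths of length at least `2`. -/
def IsAdmissible (I : TwoSidedIdeal (PathAlg K Q)) : Prop :=
  (∃ N : ℕ, ∀ (i j : Q.V) (p : Quiver.Path i j), N ≤ p.length → pathEl K Q p ∈ I) ∧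
    (∀ x ∈ I, (x : Module.End K (PMod K Q)) ∈
      Submodule.span K {f | ∃ (i j : Q.V) (p : Quiver.Path i j),
        2 ≤ p.length ∧ f = Lop K Q p})

end Ideals
section GlueAlg

variable (QA QB : BQuiver) (a : QA.V) (b : QB.V) (K : Type) [Field K]

/-- The defining ideal of the simple gluing algebra: the two-sided ideal generated by the
relations of `A` and the relations of `B`, viewed in the path algebra of the glued quiver. -/
noncomputable def glueIdeal (RA : Set (PIdx QA →₀ K)) (RB : Set (PIdx QB →₀ K)) :
    TwoSidedIdeal (PathAlg K (glueQ QA QB a b)) :=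
  relIdeal K (glueQ QA QB a b) (liftA QA QB a b K '' RA ∪ liftB QA QB a b K '' RB)

/-- The bound quiver algebra `A = KQ_A/I_A`. -/
noncomputable abbrev ARing (RA : Set (PIdx QA →₀ K)) : Type :=
  BQAlg K QA (relIdeal K QA RA)

/-- The simple gluing algebra `Λ = KQ/⟨I_A, I_B⟩`. -/
noncomputable abbrev LRing (RA : Set (PIdx QA →₀ K)) (RB : Set (PIdx QB →₀ K)) : Type :=
  BQAlg K (glueQ QA QB a b) (glueIdeal QA QB a b K RA RB)

variable (RA : Set (PIdx QA →₀ K)) (RB : Set (PIdx QB →₀ K))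

/-- The idempotent `e_v` of `Λ` at a vertex `v` of the glued quiver. -/
noncomputable def eVert (v : (glueQ QA QB a b).V) : LRing QA QB a b K RA RB :=
  BQmk K _ _ (pathEl K (glueQ QA QB a b) (Quiver.Path.nil : Quiver.Path v v))

/-- The idempotent `e_A = ∑_{i ∈ Q_A} e_i` of `Λ`. -/
noncomputable def glueEA : LRing QA QB a b K RA RB :=
  ∑ i : QA.V, eVert QA QB a b K RA RB ((embA QA QB a b).obj i)

/-- The idempotent `e_B = ∑_{i ∈ Q_B} e_i` of `Λ`. -/
noncomputable def glueEB : LRing QA QB a b K RA RB :=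
  ∑ i : QB.V, eVert QA QB a b K RA RB ((embB QA QB a b).obj i)

/-- The indecomposable projective `Λ`-module `U(v) = Λ e_v` at the glued vertex. -/
noncomputable def projUv : Submodule (LRing QA QB a b K RA RB) (LRing QA QB a b K RA RB) :=
  LinearMap.range (LinearMap.toSpanSingleton (LRing QA QB a b K RA RB)
    (LRing QA QB a b K RA RB) (eVert QA QB a b K RA RB (gluedV QA QB a b)))

end GlueAlg

/-- The additive subgroup `e•M` of an `R`-module `M` determined by an idempotent `e`,
given by the fixed points of the action of `e`. -/
def cornerSub (R : Type) [Ring R] (e : R) (M : Type) [AddCommGroup M] [Module R M] :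
    AddSubgroup M where
  carrier := {m | e • m = m}
  add_mem' := fun {x y} hx hy => by
    simp only [Set.mem_setOf_eq, smul_add] at *
    rw [hx, hy]
  zero_mem' := smul_zero e
  neg_mem' := fun {x} hx => by
    simp only [Set.mem_setOf_eq, smul_neg] at *
    rw [hx]


/-! ### Generic facts on the path algebra -/

section PathAlgBasics

variable {K : Type} [Field K] {Q : BQuiver}

/-- A path as an index. -/
def pI {i j : Q.V} (p : Quiver.Path i j) : PIdx Q := ⟨i, j, p⟩

/-- The basis vector of the free module attached to a path. -/
noncomputable def bs (K : Type) [Field K] {Q : BQuiver} {i j : Q.V} (p : Quiver.Path i j) :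
    PMod K Q :=
  (Finsupp.single (pI p) (1 : K) : PIdx Q →₀ K)

theorem Lop_single {i j : Q.V} (p : Quiver.Path i j) {k : Q.V} (q : Quiver.Path k i) :
    Lop K Q p (bs K q) = bs K (q.comp p) := by
  unfold Lop bs
  erw [Finsupp.lsum_single]
  simp [pI]
  rfl

theorem Lop_single_of_ne {i j : Q.V} (p : Quiver.Path i j) {k l : Q.V} (q : Quiver.Path k l)
    (h : l ≠ i) : Lop K Q p (bs K q) = 0 := by
  unfold Lop bs
  erw [Finsupp.lsum_single]
  simp [h, pI]

theorem end_ext {f g : Module.End K (PMod K Q)}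
    (h : ∀ (k l : Q.V) (q : Quiver.Path k l), f (bs K q) = g (bs K q)) : f = g := by
  refine Finsupp.lhom_ext' (M := K) (α := PIdx Q) (R := K) (N := PMod K Q) (fun x => ?_)
  refine LinearMap.ext_ring ?_
  obtain ⟨k, l, q⟩ := x
  exact h k l q

theorem Lop_comp {i j k : Q.V} (p : Quiver.Path i j) (q : Quiver.Path j k) :
    Lop K Q (p.comp q) = Lop K Q q * Lop K Q p := by
  apply end_ext
  intro x y r
  rw [Module.End.mul_apply]
  by_cases h : y = i
  · subst h
    rw [Lop_single, Lop_single, Lop_single, Quiver.Path.comp_assoc]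
  · rw [Lop_single_of_ne _ _ h, Lop_single_of_ne _ _ h, map_zero]

theorem Lop_mul_of_ne {i j k l : Q.V} (p : Quiver.Path i j) (q : Quiver.Path k l) (hjk : j ≠ k) :
    Lop K Q q * Lop K Q p = 0 := by
  apply end_ext
  intro x y r
  rw [Module.End.mul_apply]
  by_cases h : y = i
  · subst h
    rw [Lop_single, Lop_single_of_ne _ _ hjk]; rfl
  · rw [Lop_single_of_ne _ _ h, map_zero]; rfl

theorem one_eq_sum_Lop :
    (1 : Module.End K (PMod K Q)) = ∑ i : Q.V, Lop K Q (Quiver.Path.nil : Quiver.Path i i) := by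
  apply end_ext
  intro x y r
  rw [LinearMap.sum_apply, Finset.sum_eq_single y]
  · rw [Lop_single]; rfl
  · intro z _ hz
    exact Lop_single_of_ne _ _ hz.symm
  · simp

theorem pathEl_comp {i j k : Q.V} (p : Quiver.Path i j) (q : Quiver.Path j k) :
    pathEl K Q (p.comp q) = pathEl K Q q * pathEl K Q p :=
  Subtype.ext (Lop_comp p q)

theorem pathEl_mul_of_ne {i j k l : Q.V} (p : Quiver.Path i j) (q : Quiver.Path k l)
    (hjk : j ≠ k) : pathEl K Q q * pathEl K Q p = 0 :=
  Subtype.ext (Lop_mul_of_ne p q hjk)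

theorem mem_span_Lop (x : Module.End K (PMod K Q)) (hx : x ∈ PathAlg K Q) :
    x ∈ Submodule.span K {f | ∃ (i j : Q.V) (p : Quiver.Path i j), f = Lop K Q p} := by
  induction hx using Algebra.adjoin_induction with
  | mem x hx => exact Submodule.subset_span hx
  | algebraMap r =>
    rw [Algebra.algebraMap_eq_smul_one, one_eq_sum_Lop]
    exact Submodule.smul_mem _ _ (Submodule.sum_mem _ fun i _ => Submodule.subset_span ⟨_, _, _, rfl⟩)
  | add x y _ _ hx hy => exact Submodule.add_mem _ hx hy
  | mul x y _ _ hx hy =>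
    have h := Submodule.mul_mem_mul hx hy
    rw [Submodule.span_mul_span] at h
    refine Submodule.span_le.2 ?_ h
    rintro _ ⟨_, ⟨i, j, p, rfl⟩, _, ⟨k, l, q, rfl⟩, rfl⟩
    by_cases e : l = i
    · subst e
      exact Submodule.subset_span ⟨_, _, _, (Lop_comp q p).symm⟩
    · simp only [Lop_mul_of_ne q p e]
      exact Submodule.zero_mem _

/-- Induction principle: the path algebra is spanned by the paths. -/
theorem pathAlg_induction {P : PathAlg K Q → Prop}
    (hp : ∀ (i j : Q.V) (p : Quiver.Path i j), P (pathEl K Q p))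
    (h0 : P 0) (hadd : ∀ x y, P x → P y → P (x + y)) (hs : ∀ (c : K) x, P x → P (c • x))
    (x : PathAlg K Q) : P x := by
  obtain ⟨x, hx⟩ := x
  have h := mem_span_Lop x hx
  suffices H : ∃ hx : x ∈ PathAlg K Q, P ⟨x, hx⟩ from H.2
  clear hx
  induction h using Submodule.span_induction with
  | mem x hx =>
    obtain ⟨i, j, p, rfl⟩ := hx
    exact ⟨(pathEl K Q p).2, hp i j p⟩
  | zero => exact ⟨Subalgebra.zero_mem _, h0⟩
  | add x y _ _ hx hy =>
    obtain ⟨hx, hx'⟩ := hx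
    obtain ⟨hy, hy'⟩ := hy
    exact ⟨Subalgebra.add_mem _ hx hy, hadd _ _ hx' hy'⟩
  | smul c x _ hx =>
    obtain ⟨hx, hx'⟩ := hx
    exact ⟨Subalgebra.smul_mem _ hx c, hs c _ hx'⟩

/-- The sum of the trivial paths, in the free module. -/
noncomputable def oneV (K : Type) [Field K] (Q : BQuiver) : PMod K Q :=
  ∑ i : Q.V, bs K (Quiver.Path.nil : Quiver.Path i i)

theorem Lop_oneV {i j : Q.V} (p : Quiver.Path i j) :
    Lop K Q p (oneV K Q) = bs K p := by
  unfold oneV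
  rw [map_sum, Finset.sum_eq_single i]
  · rw [Lop_single, Quiver.Path.nil_comp]
  · intro z _ hz
    exact Lop_single_of_ne _ _ hz
  · simp

variable {E : Type} [Ring E] [Algebra K E]

/-- Linear extension of a function on paths to the path algebra. -/
noncomputable def psi (F : PIdx Q → E) : PathAlg K Q →ₗ[K] E :=
  (Finsupp.lsum K (fun q : PIdx Q => LinearMap.toSpanSingleton K E (F q)) :
      (PIdx Q →₀ K) →ₗ[K] E) ∘ₗ
    (LinearMap.applyₗ (oneV K Q) : Module.End K (PMod K Q) →ₗ[K] PMod K Q) ∘ₗ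
    (PathAlg K Q).val.toLinearMap

theorem psi_pathEl (F : PIdx Q → E) {i j : Q.V} (p : Quiver.Path i j) :
    psi F (pathEl K Q p) = F (pI p) := by
  have : psi F (pathEl K Q p) = (Finsupp.lsum K
      (fun q : PIdx Q => LinearMap.toSpanSingleton K E (F q)) : (PIdx Q →₀ K) →ₗ[K] E)
      (Lop K Q p (oneV K Q)) := rfl
  rw [this, Lop_oneV]
  unfold bs
  rw [Finsupp.lsum_single]
  simp [LinearMap.toSpanSingleton_apply]

theorem psi_mul (F : PIdx Q → E)
    (hc : ∀ {i j k : Q.V} (p : Quiver.Path i j) (q : Quiver.Path j k),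
      F (pI (p.comp q)) = F (pI q) * F (pI p))
    (hz : ∀ {i j k l : Q.V} (p : Quiver.Path i j) (q : Quiver.Path k l), j ≠ k →
      F (pI q) * F (pI p) = 0) (x y : PathAlg K Q) :
    psi F (x * y) = psi F x * psi F y := by
  induction x using pathAlg_induction with
  | h0 => simp
  | hadd x x' hx hx' => rw [add_mul, map_add, map_add, add_mul, hx, hx']
  | hs c x hx => rw [smul_mul_assoc, map_smul, map_smul, smul_mul_assoc, hx]
  | hp k l q =>
    induction y using pathAlg_induction with
    | h0 => simp
    | hadd x x' hx hx' => rw [mul_add, map_add, map_add, mul_add, hx, hx']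
    | hs c x hx => rw [mul_smul_comm, map_smul, map_smul, mul_smul_comm, hx]
    | hp i j p =>
      by_cases h : j = k
      · subst h
        rw [← pathEl_comp, psi_pathEl, psi_pathEl, psi_pathEl, hc]
      · rw [pathEl_mul_of_ne _ _ h, psi_pathEl, psi_pathEl, hz _ _ h, map_zero]

theorem evalPA_eq_sum (x : PIdx Q →₀ K) :
    evalPA K Q x = x.sum fun q c => c • pathEl K Q q.2.2 := by
  apply Subtype.ext
  rw [Finsupp.sum, AddSubmonoidClass.coe_finsetSum]
  simp [evalPA, evalEnd, Finsupp.lsum_apply, Finsupp.sum, LinearMap.toSpanSingleton_apply, pathEl]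

/-- A multiplicative linear map killing the relations kills the ideal. -/
theorem relIdeal_le_ker (R : Set (PIdx Q →₀ K)) (f : PathAlg K Q →ₗ[K] E)
    (hm : ∀ x y, f (x * y) = f x * f y) (h : ∀ r ∈ R, f (evalPA K Q r) = 0) :
    ∀ x ∈ relIdeal K Q R, f x = 0 := by
  let f' : PathAlg K Q →ₙ+* E :=
    { toFun := f, map_mul' := hm, map_zero' := map_zero f, map_add' := map_add f }
  have : relIdeal K Q R ≤ TwoSidedIdeal.ker f' := by
    unfold relIdeal
    rw [TwoSidedIdeal.span_le]
    rintro _ ⟨r, hr, rfl⟩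
    exact (TwoSidedIdeal.mem_ker f').2 (h r hr)
  intro x hx
  exact (TwoSidedIdeal.mem_ker f').1 (this hx)

end PathAlgBasics

/-! ### Pulling back along quiver embeddings -/

section Pull

variable {K : Type} [Field K] {Q Q' : BQuiver} {E : Type} [Ring E] [Algebra K E]

/-- Pull back of a linear map along a morphism of quivers. -/
noncomputable def pull (φ : Q'.V ⥤q Q.V) (f : PathAlg K Q →ₗ[K] E) : PathAlg K Q' →ₗ[K] E :=
  psi fun q => f (pathEl K Q (φ.mapPath q.2.2))

theorem pull_pathEl (φ : Q'.V ⥤q Q.V) (f : PathAlg K Q →ₗ[K] E) {i j : Q'.V}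
    (p : Quiver.Path i j) : pull φ f (pathEl K Q' p) = f (pathEl K Q (φ.mapPath p)) :=
  psi_pathEl _ p

theorem pull_mul (φ : Q'.V ⥤q Q.V) (hφ : Function.Injective φ.obj) (f : PathAlg K Q →ₗ[K] E)
    (hf : ∀ x y, f (x * y) = f x * f y) (x y : PathAlg K Q') :
    pull φ f (x * y) = pull φ f x * pull φ f y := by
  apply psi_mul
  · intro i j k p q
    simp only [pI]
    rw [Prefunctor.mapPath_comp, pathEl_comp, hf]
  · intro i j k l p q h
    simp only [pI]
    rw [← hf, pathEl_mul_of_ne _ _ (fun e => h (hφ e)), map_zero]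

theorem pull_evalPA (φ : Q'.V ⥤q Q.V) (f : PathAlg K Q →ₗ[K] E) (r : PIdx Q' →₀ K) :
    pull φ f (evalPA K Q' r) = f (evalPA K Q (Finsupp.mapDomain
      (fun q : PIdx Q' => pI (φ.mapPath q.2.2)) r)) := by
  rw [evalPA_eq_sum, evalPA_eq_sum, Finsupp.sum_mapDomain_index, Finsupp.sum, Finsupp.sum,
    map_sum, map_sum]
  · refine Finset.sum_congr rfl fun q _ => ?_
    rw [map_smul, map_smul, pull_pathEl]
    rfl
  · intro q; exact zero_smul _ _
  · intro q c d; exact add_smul _ _ _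

theorem pull_kills (φ : Q'.V ⥤q Q.V) (hφ : Function.Injective φ.obj) (f : PathAlg K Q →ₗ[K] E)
    (hf : ∀ x y, f (x * y) = f x * f y) (R : Set (PIdx Q' →₀ K))
    (h : ∀ r ∈ R, f (evalPA K Q (Finsupp.mapDomain
      (fun q : PIdx Q' => pI (φ.mapPath q.2.2)) r)) = 0) :
    ∀ x ∈ relIdeal K Q' R, pull φ f x = 0 :=
  relIdeal_le_ker R _ (pull_mul φ hφ f hf) fun r hr => by rw [pull_evalPA, h r hr]

end Pull

/-! ### Finite dimensionality by a sandwich argument -/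

theorem finite_of_sandwich {K : Type} [Field K] {E : Type} [Ring E] [Algebra K E]
    (A B : Submodule K E) (hA : A.FG) (hB : B.FG) (hAA : A * A ≤ A) (hBB : B * B ≤ B)
    (hBAB : B * A * B ≤ B) (gen : Algebra.adjoin K ((A : Set E) ∪ B) = ⊤) :
    Module.Finite K E := by
  have h1 : (1 : Submodule K E).FG := by
    rw [Submodule.one_eq_span]
    exact Submodule.fg_span_singleton 1
  set T : Submodule K E := (A ⊔ 1) * ((B ⊔ 1) * (A ⊔ 1)) with hT
  have hTfg : T.FG := (hA.sup h1).mul ((hB.sup h1).mul (hA.sup h1))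
  have hAT : A * T ≤ T := by
    rw [hT, ← mul_assoc]
    refine mul_le_mul' ?_ le_rfl
    rw [Submodule.mul_sup, mul_one]
    exact sup_le (hAA.trans le_sup_left) le_sup_left
  have hle1 : B ⊔ B * A ≤ T := by
    have e1 : (1 : Submodule K E) ≤ A ⊔ 1 := le_sup_right
    have e2 : B ≤ B ⊔ 1 := le_sup_left
    have e3 : A ≤ A ⊔ 1 := le_sup_left
    refine sup_le ?_ ?_
    · calc B = 1 * (B * 1) := by rw [one_mul, mul_one]
        _ ≤ T := mul_le_mul' e1 (mul_le_mul' e2 e1)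
    · calc B * A = 1 * (B * A) := by rw [one_mul]
        _ ≤ T := mul_le_mul' e1 (mul_le_mul' e2 e3)
  have hBT : B * T ≤ T := by
    refine le_trans ?_ hle1
    have e1 : B * (A ⊔ 1) * (B ⊔ 1) ≤ B ⊔ B * A := by
      rw [Submodule.mul_sup, mul_one, Submodule.mul_sup, mul_one, Submodule.sup_mul]
      exact sup_le (sup_le (hBAB.trans le_sup_left) (hBB.trans le_sup_left))
        (sup_le le_sup_right le_sup_left)
    calc B * T = B * (A ⊔ 1) * (B ⊔ 1) * (A ⊔ 1) := by rw [hT]; simp only [mul_assoc]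
      _ ≤ (B ⊔ B * A) * (A ⊔ 1) := mul_le_mul' e1 le_rfl
      _ ≤ B ⊔ B * A := by
        rw [Submodule.mul_sup, mul_one, Submodule.sup_mul, mul_assoc]
        exact sup_le (sup_le le_sup_right
          ((mul_le_mul' le_rfl hAA).trans le_sup_right)) le_rfl
  have key : ∀ x ∈ Algebra.adjoin K ((A : Set E) ∪ B), ∀ y ∈ T, x * y ∈ T := by
    intro x hx
    induction hx using Algebra.adjoin_induction with
    | mem x hx =>
      intro y hy
      rcases hx with hx | hx
      · exact hAT (Submodule.mul_mem_mul hx hy)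
      · exact hBT (Submodule.mul_mem_mul hx hy)
    | algebraMap r =>
      intro y hy
      rw [← Algebra.smul_def]
      exact T.smul_mem r hy
    | add x x' _ _ h h' =>
      intro y hy
      rw [add_mul]
      exact T.add_mem (h y hy) (h' y hy)
    | mul x x' _ _ h h' =>
      intro y hy
      rw [mul_assoc]
      exact h _ (h' y hy)
  have h1T : (1 : E) ∈ T := by
    have e : (1 : E) ∈ A ⊔ 1 := (le_sup_right : (1 : Submodule K E) ≤ A ⊔ 1) (Submodule.mem_one.2 ⟨1, map_one _⟩)
    have e' : (1 : E) ∈ B ⊔ 1 := (le_sup_right : (1 : Submodule K E) ≤ B ⊔ 1) (Submodule.mem_one.2 ⟨1, map_one _⟩)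
    have := Submodule.mul_mem_mul e (Submodule.mul_mem_mul e' e)
    simpa using this
  refine ⟨?_⟩
  have : T = ⊤ := by
    rw [eq_top_iff]
    intro x _
    have := key x (by rw [gen]; trivial) 1 h1T
    simpa using this
  rwa [← this]

/-! ### The quotient algebra -/

section Quot

variable {K : Type} [Field K] {Q : BQuiver}

/-- The quotient map as a linear map. -/
noncomputable def qmk (I : TwoSidedIdeal (PathAlg K Q)) : PathAlg K Q →ₗ[K] I.ringCon.Quotient where
  toFun x := (x : I.ringCon.Quotient)
  map_add' _ _ := rfl
  map_smul' _ _ := rfl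

theorem qmk_mul (I : TwoSidedIdeal (PathAlg K Q)) (x y : PathAlg K Q) :
    qmk I (x * y) = qmk I x * qmk I y := rfl

theorem qmk_eq_zero (I : TwoSidedIdeal (PathAlg K Q)) (x : PathAlg K Q) :
    qmk I x = 0 ↔ x ∈ I := by
  rw [TwoSidedIdeal.mem_iff]
  exact RingCon.eq _

theorem qmk_surj (I : TwoSidedIdeal (PathAlg K Q)) : Function.Surjective (qmk I) :=
  fun x => Quotient.inductionOn' x fun y => ⟨y, rfl⟩

theorem finite_BQ (I : TwoSidedIdeal (PathAlg K Q)) (h : Module.Finite K I.ringCon.Quotient) :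
    FiniteDimensional K (BQAlgModK K Q I) := by
  let S := Submodule.restrictScalars K (TwoSidedIdeal.asIdeal I)
  have hk : LinearMap.ker (qmk I) = S := by
    ext x
    rw [LinearMap.mem_ker, qmk_eq_zero]
    rfl
  let g : (PathAlg K Q ⧸ S) →ₗ[K] I.ringCon.Quotient := S.liftQ (qmk I) hk.ge
  have hg : Function.Injective g := by
    rw [← LinearMap.ker_eq_bot]
    exact Submodule.ker_liftQ_eq_bot _ _ _ hk.le
  exact Module.Finite.of_injective g hg

theorem range_fd {E : Type} [Ring E] [Algebra K E] (I : TwoSidedIdeal (PathAlg K Q))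
    (h : FiniteDimensional K (BQAlgModK K Q I)) (f : PathAlg K Q →ₗ[K] E)
    (hf : ∀ x ∈ I, f x = 0) : FiniteDimensional K (LinearMap.range f) := by
  let S := Submodule.restrictScalars K (TwoSidedIdeal.asIdeal I)
  have : FiniteDimensional K (PathAlg K Q ⧸ S) := h
  have hk : S ≤ LinearMap.ker f := fun x hx => hf x hx
  rw [← Submodule.range_liftQ S f hk]
  infer_instance

end Quot

/-! ### The glued quiver -/

section GlueFin

variable {QA QB : BQuiver} {a : QA.V} {b : QB.V}

theorem vmapB_inj : Function.Injective (vmapB QA QB a b) := by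
  intro x y h
  unfold vmapB at h
  split_ifs at h with h1 h2 h2
  · rw [h1, h2]
  · simpa using h

theorem vmapB_eq_inl {x : QB.V} {i : QA.V} (h : vmapB QA QB a b x = Sum.inl i) :
    x = b ∧ i = a := by
  unfold vmapB at h
  split_ifs at h with h1
  exact ⟨h1, (Sum.inl.inj h).symm⟩

theorem vmapB_self : vmapB QA QB a b b = Sum.inl a := by simp [vmapB]

theorem vmapB_of_ne {x : QB.V} (h : x ≠ b) : vmapB QA QB a b x = Sum.inr ⟨x, h⟩ := by
  simp [vmapB, h]

theorem embA_inj : Function.Injective (embA QA QB a b).obj := Sum.inl_injective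

theorem embB_inj : Function.Injective (embB QA QB a b).obj := vmapB_inj

variable {K : Type} [Field K]

theorem pathEl_nil_congr {Q : BQuiver} {i j : Q.V} (h : i = j) :
    pathEl K Q (Quiver.Path.nil : Quiver.Path i i)
      = pathEl K Q (Quiver.Path.nil : Quiver.Path j j) := by
  subst h; rfl

theorem embB_nil_b : pathEl K (glueQ QA QB a b)
      ((embB QA QB a b).mapPath (Quiver.Path.nil : Quiver.Path b b)) =
    pathEl K (glueQ QA QB a b) ((embA QA QB a b).mapPath (Quiver.Path.nil : Quiver.Path a a)) :=
  pathEl_nil_congr vmapB_self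

/-- Every path of the glued quiver is a product of paths of `Q_A` and `Q_B`. -/
theorem glue_path_mem {E : Type} [Ring E] [Algebra K E]
    (f : PathAlg K (glueQ QA QB a b) →ₗ[K] E) (hf : ∀ x y, f (x * y) = f x * f y)
    (S : Subalgebra K E)
    (hA : ∀ (i j : QA.V) (p : Quiver.Path i j), f (pathEl K _ ((embA QA QB a b).mapPath p)) ∈ S)
    (hB : ∀ (i j : QB.V) (p : Quiver.Path i j), f (pathEl K _ ((embB QA QB a b).mapPath p)) ∈ S)
    {i j : (glueQ QA QB a b).V} (p : Quiver.Path i j) : f (pathEl K _ p) ∈ S := by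
  induction p with
  | nil =>
    rcases i with i | ⟨i, hi⟩
    · exact hA i i Quiver.Path.nil
    · have := hB i i Quiver.Path.nil
      rw [Prefunctor.mapPath_nil, pathEl_nil_congr (show (embB QA QB a b).obj i = Sum.inr ⟨i, hi⟩
        from vmapB_of_ne hi)] at this
      exact this
  | cons p e ih =>
    have : Quiver.Path.cons p e = p.comp e.toPath := rfl
    rw [this, pathEl_comp, hf]
    refine S.mul_mem ?_ ih
    clear this ih
    obtain ⟨e | e, rfl, rfl⟩ := e
    · exact hA _ _ (Quiver.Hom.toPath (⟨e, rfl, rfl⟩ : QA.s e ⟶ QA.t e))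
    · exact hB _ _ (Quiver.Hom.toPath (⟨e, rfl, rfl⟩ : QB.s e ⟶ QB.t e))

/-- The span of the images of the paths of a subquiver. -/
noncomputable def spanImg {Q Q' : BQuiver} {E : Type} [Ring E] [Algebra K E]
    (φ : Q'.V ⥤q Q.V) (f : PathAlg K Q →ₗ[K] E) : Submodule K E :=
  Submodule.span K {x | ∃ (i j : Q'.V) (p : Quiver.Path i j), x = f (pathEl K Q (φ.mapPath p))}

theorem spanImg_mul {Q Q' : BQuiver} {E : Type} [Ring E] [Algebra K E]
    (φ : Q'.V ⥤q Q.V) (hφ : Function.Injective φ.obj) (f : PathAlg K Q →ₗ[K] E)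
    (hf : ∀ x y, f (x * y) = f x * f y) : spanImg φ f * spanImg φ f ≤ spanImg φ f := by
  unfold spanImg
  rw [Submodule.span_mul_span, Submodule.span_le]
  rintro _ ⟨_, ⟨i, j, p, rfl⟩, _, ⟨k, l, q, rfl⟩, rfl⟩
  by_cases e : l = i
  · subst e
    refine Submodule.subset_span ⟨_, _, q.comp p, ?_⟩
    rw [Prefunctor.mapPath_comp, pathEl_comp, hf]
  · simp only [← hf]
    rw [pathEl_mul_of_ne _ _ (fun h => e (hφ h)), map_zero]
    exact Submodule.zero_mem _

theorem spanImg_fg {Q Q' : BQuiver} {E : Type} [Ring E] [Algebra K E]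
    (φ : Q'.V ⥤q Q.V) (f : PathAlg K Q →ₗ[K] E) (I : TwoSidedIdeal (PathAlg K Q'))
    (h : FiniteDimensional K (BQAlgModK K Q' I))
    (hf : ∀ x ∈ I, pull φ f x = 0) : (spanImg φ f).FG := by
  have := range_fd I h _ hf
  have hle : spanImg φ f ≤ LinearMap.range (pull φ f) := by
    unfold spanImg
    rw [Submodule.span_le]
    rintro _ ⟨i, j, p, rfl⟩
    exact ⟨_, pull_pathEl φ f p⟩
  have := Submodule.finiteDimensional_of_le hle
  exact (Submodule.fg_iff_finiteDimensional _).2 inferInstance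

theorem spanImg_sandwich {Q Q₁ Q₂ : BQuiver} {E : Type} [Ring E] [Algebra K E]
    (φ : Q₁.V ⥤q Q.V) (χ : Q₂.V ⥤q Q.V) (f : PathAlg K Q →ₗ[K] E)
    (hχ : Function.Injective χ.obj)
    (hf : ∀ x y, f (x * y) = f x * f y) (a : Q₁.V) (b : Q₂.V)
    (hmeet : ∀ i k, χ.obj k = φ.obj i → k = b ∧ i = a)
    (hnil : f (pathEl K Q (φ.mapPath (Quiver.Path.nil : Quiver.Path a a))) =
      f (pathEl K Q (χ.mapPath (Quiver.Path.nil : Quiver.Path b b))))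
    (hz : ∀ p : Quiver.Path a a, p ≠ Quiver.Path.nil → f (pathEl K Q (φ.mapPath p)) = 0) :
    spanImg χ f * spanImg φ f * spanImg χ f ≤ spanImg χ f := by
  have hBB := spanImg_mul χ hχ f hf
  conv_lhs => unfold spanImg
  rw [Submodule.span_mul_span, Submodule.span_mul_span, Submodule.span_le]
  rintro _ ⟨_, ⟨_, ⟨i, j, p, rfl⟩, _, ⟨k, l, q, rfl⟩, rfl⟩, _, ⟨m, n, r, rfl⟩, rfl⟩
  by_cases e : χ.obj i = φ.obj l
  · by_cases e' : χ.obj n = φ.obj k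
    · obtain ⟨rfl, rfl⟩ := hmeet _ _ e
      obtain ⟨rfl, rfl⟩ := hmeet _ _ e'
      by_cases hq : q = Quiver.Path.nil
      · subst hq
        simp only [hnil]
        refine hBB (Submodule.mul_mem_mul (hBB (Submodule.mul_mem_mul ?_ ?_)) ?_) <;>
        exact Submodule.subset_span ⟨_, _, _, rfl⟩
      · simp only [hz q hq, mul_zero, zero_mul]
        exact Submodule.zero_mem _
    · simp only [mul_assoc, ← hf]
      rw [pathEl_mul_of_ne _ _ e', mul_zero, map_zero]
      exact Submodule.zero_mem _
  · simp only [← hf]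
    rw [pathEl_mul_of_ne _ _ (fun h => e h.symm), zero_mul, map_zero]
    exact Submodule.zero_mem _

theorem glue_kills {RA : Set (PIdx QA →₀ K)} {RB : Set (PIdx QB →₀ K)} :
    (∀ x ∈ relIdeal K QA RA, pull (embA QA QB a b) (qmk (glueIdeal QA QB a b K RA RB)) x = 0) ∧
    (∀ x ∈ relIdeal K QB RB, pull (embB QA QB a b) (qmk (glueIdeal QA QB a b K RA RB)) x = 0) := by
  constructor
  · apply pull_kills _ embA_inj _ (qmk_mul _)
    intro r hr
    rw [qmk_eq_zero]
    exact TwoSidedIdeal.subset_span ⟨_, Or.inl ⟨r, hr, rfl⟩, rfl⟩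
  · apply pull_kills _ embB_inj _ (qmk_mul _)
    intro r hr
    rw [qmk_eq_zero]
    exact TwoSidedIdeal.subset_span ⟨_, Or.inr ⟨r, hr, rfl⟩, rfl⟩

theorem glue_finite (RA : Set (PIdx QA →₀ K)) (RB : Set (PIdx QB →₀ K))
    (fdA : FiniteDimensional K (BQAlgModK K QA (relIdeal K QA RA)))
    (fdB : FiniteDimensional K (BQAlgModK K QB (relIdeal K QB RB)))
    (h : (∀ p : Quiver.Path a a, p ≠ Quiver.Path.nil → pathEl K QA p ∈ relIdeal K QA RA) ∨
        (∀ p : Quiver.Path b b, p ≠ Quiver.Path.nil → pathEl K QB p ∈ relIdeal K QB RB)) :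
    FiniteDimensional K
        (BQAlgModK K (glueQ QA QB a b) (glueIdeal QA QB a b K RA RB)) := by
  apply finite_BQ
  obtain ⟨kA, kB⟩ := glue_kills (QA := QA) (QB := QB) (a := a) (b := b) (RA := RA) (RB := RB)
  set f := qmk (glueIdeal QA QB a b K RA RB) with hfdef
  have hf : ∀ x y, f (x * y) = f x * f y := qmk_mul _
  have gA := spanImg_fg _ f _ fdA kA
  have gB := spanImg_fg _ f _ fdB kB
  have mA := spanImg_mul (embA QA QB a b) embA_inj f hf
  have mB := spanImg_mul (embB QA QB a b) embB_inj f hf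
  have gen : Algebra.adjoin K ((spanImg (embA QA QB a b) f : Set (glueIdeal QA QB a b K RA RB).ringCon.Quotient) ∪
      (spanImg (embB QA QB a b) f : Set (glueIdeal QA QB a b K RA RB).ringCon.Quotient)) = ⊤ := by
    rw [eq_top_iff]
    rintro x -
    obtain ⟨x, rfl⟩ := qmk_surj _ x
    rw [← hfdef]
    induction x using pathAlg_induction with
    | h0 => rw [map_zero]; exact Subalgebra.zero_mem _
    | hadd x y hx hy => rw [map_add]; exact Subalgebra.add_mem _ hx hy
    | hs c x hx => rw [map_smul]; exact Subalgebra.smul_mem _ hx c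
    | hp i j p =>
      refine glue_path_mem f hf _ ?_ ?_ p
      · intro i j p
        exact Algebra.subset_adjoin (Or.inl (Submodule.subset_span ⟨_, _, _, rfl⟩))
      · intro i j p
        exact Algebra.subset_adjoin (Or.inr (Submodule.subset_span ⟨_, _, _, rfl⟩))
  rcases h with h | h
  · refine finite_of_sandwich _ _ gA gB mA mB ?_ gen
    refine spanImg_sandwich _ _ f embB_inj hf a b ?_ ?_ ?_
    · intro i k e
      exact vmapB_eq_inl e
    · rw [embB_nil_b]
    · intro p hp
      rw [← pull_pathEl]
      exact kA _ (h p hp)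
  · refine finite_of_sandwich _ _ gB gA mB mA ?_ (by rw [Set.union_comm]; exact gen)
    refine spanImg_sandwich _ _ f embA_inj hf b a ?_ ?_ ?_
    · intro i k e
      exact (vmapB_eq_inl e.symm).symm
    · rw [embB_nil_b]
    · intro p hp
      rw [← pull_pathEl]
      exact kB _ (h p hp)

end GlueFin

/-! ### Infinite dimensionality -/

section Aug

variable {K : Type} [Field K] {Q : BQuiver}

open Classical in
/-- The coefficient of the trivial path at `a`. -/
noncomputable def eps (K : Type) [Field K] {Q : BQuiver} (a : Q.V) : PathAlg K Q →ₗ[K] K :=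
  psi fun q => if q.2.2.length = 0 ∧ q.1 = a then 1 else 0

theorem eps_nil (a : Q.V) : eps K a (pathEl K Q (Quiver.Path.nil : Quiver.Path a a)) = 1 := by
  unfold eps
  rw [psi_pathEl]
  simp [pI]

theorem eps_nil_ne {a i : Q.V} (h : i ≠ a) :
    eps K a (pathEl K Q (Quiver.Path.nil : Quiver.Path i i)) = 0 := by
  unfold eps
  rw [psi_pathEl]
  simp [pI, h]

theorem eps_path {a i j : Q.V} (p : Quiver.Path i j) (h : p.length ≠ 0) :
    eps K a (pathEl K Q p) = 0 := by
  unfold eps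
  rw [psi_pathEl]
  simp [pI, h]

theorem eps_mul (a : Q.V) (x y : PathAlg K Q) : eps K a (x * y) = eps K a x * eps K a y := by
  classical
  apply psi_mul
  · intro i j k p q
    simp only [pI, Quiver.Path.length_comp]
    by_cases hp : p.length = 0
    · have := Quiver.Path.eq_of_length_zero p hp
      subst this
      simp only [hp, Nat.zero_add]
      by_cases h1 : q.length = 0 <;> by_cases h2 : i = a <;> simp [h1, h2]
    · simp [hp]
  · intro i j k l p q h
    simp only [pI]
    by_cases hp : p.length = 0
    · have := Quiver.Path.eq_of_length_zero p hp
      subst this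
      by_cases h1 : i = a
      · have h2 : k ≠ a := fun h2 => h (h1.trans h2.symm)
        simp [h2]
      · simp [h1]
    · simp [hp]

theorem eps_kills (a : Q.V) (I : TwoSidedIdeal (PathAlg K Q)) (adm : IsAdmissible K Q I) :
    ∀ x ∈ I, eps K a x = 0 := by
  intro x hx
  have h := adm.2 x hx
  obtain ⟨x, hx'⟩ := x
  simp only at h
  clear hx
  suffices H : ∃ hx : x ∈ PathAlg K Q, eps K a ⟨x, hx⟩ = 0 from H.2
  clear hx'
  induction h using Submodule.span_induction with
  | mem x hx =>
    obtain ⟨i, j, p, hl, rfl⟩ := hx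
    exact ⟨(pathEl K Q p).2, eps_path p (by omega)⟩
  | zero => exact ⟨Subalgebra.zero_mem _, map_zero (eps K a)⟩
  | add x y _ _ hx hy =>
    obtain ⟨hx, hx'⟩ := hx
    obtain ⟨hy, hy'⟩ := hy
    refine ⟨Subalgebra.add_mem _ hx hy, ?_⟩
    have := map_add (eps K a) ⟨x, hx⟩ ⟨y, hy⟩
    rw [hx', hy', add_zero] at this
    exact this
  | smul c x _ hx =>
    obtain ⟨hx, hx'⟩ := hx
    refine ⟨Subalgebra.smul_mem _ hx c, ?_⟩
    have := map_smul (eps K a) c ⟨x, hx⟩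
    rw [hx', smul_zero] at this
    exact this

/-- The representation theoretic input on each side of the gluing. -/
structure Half (K L : Type) [Field K] [Field L] [Algebra K L] {Q : BQuiver}
    (I : TwoSidedIdeal (PathAlg K Q)) {a : Q.V} (p : Quiver.Path a a)
    (M : Type) [AddCommGroup M] [Module L M] [Module K M] [IsScalarTower K L M] where
  ρ : PathAlg K Q →ₗ[K] Module.End L M
  ρmul : ∀ x y, ρ (x * y) = ρ x * ρ y
  kill : ∀ x ∈ I, ρ x = 0
  m0 : M
  f0 : M →ₗ[L] L
  f1 : M →ₗ[L] L
  em0 : ρ (pathEl K Q (Quiver.Path.nil : Quiver.Path a a)) m0 = m0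
  f00 : f0 m0 = 1
  f01 : f0 (ρ (pathEl K Q p) m0) = 0
  f10 : f1 m0 = 0
  f11 : f1 (ρ (pathEl K Q p) m0) = 1
  f0e : ∀ m, f0 (ρ (pathEl K Q (Quiver.Path.nil : Quiver.Path a a)) m) = f0 m
  f1e : ∀ m, f1 (ρ (pathEl K Q (Quiver.Path.nil : Quiver.Path a a)) m) = f1 m

/-- Linear functionals with values in `L` vanishing on `I`. -/
def MSub (K L : Type) [Field K] [Field L] [Algebra K L] {Q : BQuiver}
    (I : TwoSidedIdeal (PathAlg K Q)) : Submodule L (PathAlg K Q →ₗ[K] L) where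
  carrier := {φ | ∀ x ∈ I, φ x = 0}
  add_mem' := fun {φ χ} h h' x hx => by
    rw [LinearMap.add_apply, h x hx, h' x hx, add_zero]
  zero_mem' := fun x _ => rfl
  smul_mem' := fun c φ h x hx => by
    rw [LinearMap.smul_apply, h x hx, smul_zero]

/-- The action on `MSub`. -/
noncomputable def rhoM (K L : Type) [Field K] [Field L] [Algebra K L] {Q : BQuiver}
    (I : TwoSidedIdeal (PathAlg K Q)) : PathAlg K Q →ₗ[K] Module.End L (MSub K L I) where
  toFun x :=
    { toFun := fun φ => ⟨φ.1 ∘ₗ LinearMap.mulRight K x, fun y hy => φ.2 _ (I.mul_mem_right _ _ hy)⟩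
      map_add' := fun _ _ => rfl
      map_smul' := fun _ _ => rfl }
  map_add' x y := by
    ext φ z
    change φ.1 (z * (x + y)) = φ.1 (z * x) + φ.1 (z * y)
    rw [mul_add, map_add]
  map_smul' c x := by
    ext φ z
    change φ.1 (z * (c • x)) = c • φ.1 (z * x)
    rw [mul_smul_comm, map_smul]

theorem exists_half (K L : Type) [Field K] [Field L] [Algebra K L] {Q : BQuiver}
    (I : TwoSidedIdeal (PathAlg K Q)) (adm : IsAdmissible K Q I) {a : Q.V} (p : Quiver.Path a a)
    (hp : p ≠ Quiver.Path.nil) (hpI : pathEl K Q p ∉ I) :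
    Nonempty (Half K L I p (MSub K L I)) := by
  set e := pathEl K Q (Quiver.Path.nil : Quiver.Path a a) with he
  set P := pathEl K Q p with hP
  have hee : e * e = e := by rw [he, ← pathEl_comp]; rfl
  have hPe : P * e = P := by rw [he, hP, ← pathEl_comp, Quiver.Path.nil_comp]
  have hlen : p.length ≠ 0 := fun h => hp (Quiver.Path.eq_nil_of_length_zero p h)
  have epsP : eps K a P = 0 := eps_path p hlen
  have epse : eps K a e = 1 := eps_nil a
  let S := Submodule.restrictScalars K (TwoSidedIdeal.asIdeal I)
  obtain ⟨φ0, hφP, hφI⟩ := Submodule.exists_le_ker_of_notMem (p := S) (v := P) hpI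
  let φ1 : PathAlg K Q →ₗ[K] K := (φ0 P)⁻¹ • (φ0 - φ0 e • eps K a)
  have φ1P : φ1 P = 1 := by
    simp only [φ1, LinearMap.smul_apply, LinearMap.sub_apply, epsP, smul_eq_mul, mul_zero, sub_zero]
    exact inv_mul_cancel₀ hφP
  have φ1e : φ1 e = 0 := by
    simp [φ1, epse]
  have φ1I : ∀ x ∈ I, φ1 x = 0 := by
    intro x hx
    have h0 : φ0 x = 0 := hφI hx
    simp [φ1, h0, eps_kills a I adm x hx]
  let φ : MSub K L I := ⟨(Algebra.linearMap K L) ∘ₗ φ1 ∘ₗ LinearMap.mulRight K e, by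
    intro x hx
    simp [φ1I _ (I.mul_mem_right x e hx)]⟩
  have φap : ∀ x, φ.1 x = algebraMap K L (φ1 (x * e)) := fun x => rfl
  let ev : PathAlg K Q → (MSub K L I →ₗ[L] L) := fun x =>
    { toFun := fun χ => χ.1 x
      map_add' := fun _ _ => rfl
      map_smul' := fun _ _ => rfl }
  have hρ : ∀ (x y : PathAlg K Q) (χ : MSub K L I), (rhoM K L I x χ).1 y = χ.1 (y * x) :=
    fun _ _ _ => rfl
  have hev : ∀ (x : PathAlg K Q) (χ : MSub K L I), ev x χ = χ.1 x := fun _ _ => rfl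
  have heP : e * P = P := by
    rw [he, hP, ← pathEl_comp, Quiver.Path.comp_nil]
  refine ⟨{
    ρ := rhoM K L I
    ρmul := ?_
    kill := ?_
    m0 := φ
    f0 := ev P - φ.1 (P * P) • ev e
    f1 := ev e
    em0 := ?_
    f00 := ?_
    f01 := ?_
    f10 := ?_
    f11 := ?_
    f0e := ?_
    f1e := ?_ }⟩
  · intro x y
    ext χ z
    change χ.1 (z * (x * y)) = χ.1 (z * x * y)
    rw [mul_assoc]
  · intro x hx
    ext χ z
    exact χ.2 _ (I.mul_mem_left _ _ hx)
  · ext z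
    rw [hρ, φap, φap, mul_assoc, hee]
  · simp [hev, φap, hee, hPe, φ1P, φ1e]
  · simp [hev, hρ, φap, mul_assoc, hPe, heP, φ1P, ← hP, Algebra.smul_def]
  · simp [hev, φap, hee, φ1e]
  · simp [hev, hρ, φap, hPe, heP, φ1P, ← hP]
  · intro m
    simp [hev, hρ, hPe, hee, ← he]
  · intro m
    rw [hev, hev, hρ, hee]

end Aug

section Rep

variable {E : Type} [Ring E] {Q : BQuiver}

/-- A representation of the path algebra from vertex and arrow data. -/
def repF (Fv : Q.V → E) (Fa : Q.Arr → E) {i : Q.V} : ∀ {j : Q.V}, Quiver.Path i j → E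
  | _, Quiver.Path.nil => Fv i
  | _, Quiver.Path.cons p e => Fa e.1 * repF Fv Fa p

variable (Fv : Q.V → E) (Fa : Q.Arr → E) (hidem : ∀ i, Fv i * Fv i = Fv i)
  (horth : ∀ i j, i ≠ j → Fv i * Fv j = 0)
  (ht : ∀ e, Fv (Q.t e) * Fa e = Fa e) (hs : ∀ e, Fa e * Fv (Q.s e) = Fa e)

theorem repF_right (hidem : ∀ i, Fv i * Fv i = Fv i) {i j : Q.V} (p : Quiver.Path i j) :
    repF Fv Fa p * Fv i = repF Fv Fa p := by
  induction p with
  | nil => exact hidem i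
  | cons p e ih => rw [repF, mul_assoc, ih]

theorem repF_left (hidem : ∀ i, Fv i * Fv i = Fv i)
    (ht : ∀ e, Fv (Q.t e) * Fa e = Fa e) {i j : Q.V} (p : Quiver.Path i j) :
    Fv j * repF Fv Fa p = repF Fv Fa p := by
  cases p with
  | nil => exact hidem i
  | cons p e =>
    obtain ⟨e, rfl, rfl⟩ := e
    rw [repF, ← mul_assoc, ht]

theorem repF_comp (hidem : ∀ i, Fv i * Fv i = Fv i)
    (ht : ∀ e, Fv (Q.t e) * Fa e = Fa e) {i j k : Q.V} (p : Quiver.Path i j)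
    (q : Quiver.Path j k) : repF Fv Fa (p.comp q) = repF Fv Fa q * repF Fv Fa p := by
  induction q with
  | nil => exact (repF_left Fv Fa hidem ht p).symm
  | cons q e ih => rw [Quiver.Path.comp_cons, repF, repF, ih, mul_assoc]

theorem repF_zero (hidem : ∀ i, Fv i * Fv i = Fv i)
    (horth : ∀ i j, i ≠ j → Fv i * Fv j = 0)
    (ht : ∀ e, Fv (Q.t e) * Fa e = Fa e) {i j k l : Q.V} (p : Quiver.Path i j)
    (q : Quiver.Path k l) (h : j ≠ k) : repF Fv Fa q * repF Fv Fa p = 0 := by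
  rw [← repF_left Fv Fa hidem ht p, ← repF_right Fv Fa hidem q, mul_assoc, ← mul_assoc (Fv k),
    horth _ _ h.symm, zero_mul, mul_zero]

end Rep

section Infinite

variable {K L : Type} [Field K] [Field L] [Algebra K L] {QA QB : BQuiver} {a : QA.V} {b : QB.V}
  {IA : TwoSidedIdeal (PathAlg K QA)} {IB : TwoSidedIdeal (PathAlg K QB)}
  {p : Quiver.Path a a} {q : Quiver.Path b b}
  {MA : Type} [AddCommGroup MA] [Module L MA] [Module K MA] [IsScalarTower K L MA]
  {MB : Type} [AddCommGroup MB] [Module L MB] [Module K MB] [IsScalarTower K L MB]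

/-- The trivial path, in the path algebra. -/
noncomputable def ve (K : Type) [Field K] {Q : BQuiver} (i : Q.V) : PathAlg K Q :=
  pathEl K Q (Quiver.Path.nil : Quiver.Path i i)

theorem ve_idem {Q : BQuiver} (i : Q.V) : ve K i * ve K i = ve K i := by
  unfold ve
  rw [← pathEl_comp]
  rfl

theorem ve_orth {Q : BQuiver} {i j : Q.V} (h : i ≠ j) : ve K i * ve K j = 0 :=
  pathEl_mul_of_ne _ _ h.symm

/-- The action of one side on the glued representation. -/
noncomputable def alpha (HA : Half K L IA p MA) (HB : Half K L IB q MB) :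
    PathAlg K QA →ₗ[K] Module.End L (MA × MB) where
  toFun x := (HA.ρ x).prodMap (eps K a x • HB.ρ (ve K b))
  map_add' x y := by
    refine LinearMap.ext fun m => ?_
    simp [add_smul]
  map_smul' c x := by
    refine LinearMap.ext fun m => ?_
    simp [mul_smul]

/-- The action of the other side, before twisting. -/
noncomputable def beta0 (HA : Half K L IA p MA) (HB : Half K L IB q MB) :
    PathAlg K QB →ₗ[K] Module.End L (MA × MB) where
  toFun x := (eps K b x • HA.ρ (ve K a)).prodMap (HB.ρ x)
  map_add' x y := by
    refine LinearMap.ext fun m => ?_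
    simp [add_smul]
  map_smul' c x := by
    refine LinearMap.ext fun m => ?_
    simp [mul_smul]

variable (HA : Half K L IA p MA) (HB : Half K L IB q MB)

theorem alpha_apply (x : PathAlg K QA) (m : MA) (n : MB) :
    alpha HA HB x (m, n) = (HA.ρ x m, eps K a x • HB.ρ (ve K b) n) := rfl

theorem beta0_apply (x : PathAlg K QB) (m : MA) (n : MB) :
    beta0 HA HB x (m, n) = (eps K b x • HA.ρ (ve K a) m, HB.ρ x n) := rfl

theorem Half.idem {Q : BQuiver} {I : TwoSidedIdeal (PathAlg K Q)} {a : Q.V}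
    {p : Quiver.Path a a} (H : Half K L I p MA) (i : Q.V) (m : MA) :
    H.ρ (ve K i) (H.ρ (ve K i) m) = H.ρ (ve K i) m := by
  rw [← Module.End.mul_apply, ← H.ρmul, ve_idem]

theorem Half.orth {Q : BQuiver} {I : TwoSidedIdeal (PathAlg K Q)} {a : Q.V}
    {p : Quiver.Path a a} (H : Half K L I p MA) {i j : Q.V} (h : i ≠ j) (m : MA) :
    H.ρ (ve K i) (H.ρ (ve K j) m) = 0 := by
  rw [← Module.End.mul_apply, ← H.ρmul, ve_orth h, map_zero]
  rfl

/-- The vector `p m₀`. -/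
noncomputable def Half.m1 {Q : BQuiver} {I : TwoSidedIdeal (PathAlg K Q)} {a : Q.V}
    {p : Quiver.Path a a} (H : Half K L I p MA) : MA := H.ρ (pathEl K Q p) H.m0

theorem Half.em1 {Q : BQuiver} {I : TwoSidedIdeal (PathAlg K Q)} {a : Q.V}
    {p : Quiver.Path a a} (H : Half K L I p MA) : H.ρ (ve K a) H.m1 = H.m1 := by
  unfold Half.m1 ve
  rw [← Module.End.mul_apply, ← H.ρmul, ← pathEl_comp, Quiver.Path.comp_nil]

theorem Half.em0' {Q : BQuiver} {I : TwoSidedIdeal (PathAlg K Q)} {a : Q.V}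
    {p : Quiver.Path a a} (H : Half K L I p MA) : H.ρ (ve K a) H.m0 = H.m0 := H.em0

theorem Half.f01' {Q : BQuiver} {I : TwoSidedIdeal (PathAlg K Q)} {a : Q.V}
    {p : Quiver.Path a a} (H : Half K L I p MA) : H.f0 H.m1 = 0 := H.f01

theorem Half.f11' {Q : BQuiver} {I : TwoSidedIdeal (PathAlg K Q)} {a : Q.V}
    {p : Quiver.Path a a} (H : Half K L I p MA) : H.f1 H.m1 = 1 := H.f11

theorem Half.f0e' {Q : BQuiver} {I : TwoSidedIdeal (PathAlg K Q)} {a : Q.V}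
    {p : Quiver.Path a a} (H : Half K L I p MA) (m : MA) : H.f0 (H.ρ (ve K a) m) = H.f0 m :=
  H.f0e m

theorem Half.f1e' {Q : BQuiver} {I : TwoSidedIdeal (PathAlg K Q)} {a : Q.V}
    {p : Quiver.Path a a} (H : Half K L I p MA) (m : MA) : H.f1 (H.ρ (ve K a) m) = H.f1 m :=
  H.f1e m

theorem Half.f_ne {Q : BQuiver} {I : TwoSidedIdeal (PathAlg K Q)} {a : Q.V}
    {p : Quiver.Path a a} (H : Half K L I p MA) {j : Q.V} (h : j ≠ a) (m : MA) :
    H.f0 (H.ρ (ve K j) m) = 0 ∧ H.f1 (H.ρ (ve K j) m) = 0 := by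
  rw [← H.f0e', ← H.f1e', H.orth h.symm, map_zero, map_zero]
  exact ⟨rfl, rfl⟩

theorem Half.m_ne {Q : BQuiver} {I : TwoSidedIdeal (PathAlg K Q)} {a : Q.V}
    {p : Quiver.Path a a} (H : Half K L I p MA) {j : Q.V} (h : j ≠ a) :
    H.ρ (ve K j) H.m0 = 0 ∧ H.ρ (ve K j) H.m1 = 0 := by
  rw [← H.em0', ← H.em1, H.orth h, H.orth h]
  exact ⟨rfl, rfl⟩

theorem alpha_mul (x y : PathAlg K QA) :
    alpha HA HB (x * y) = alpha HA HB x * alpha HA HB y := by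
  refine LinearMap.ext fun ⟨m, n⟩ => ?_
  rw [Module.End.mul_apply, alpha_apply, alpha_apply, alpha_apply, HA.ρmul, eps_mul,
    Module.End.mul_apply, LinearMap.map_smul_of_tower, HB.idem, mul_smul]

theorem beta0_mul (x y : PathAlg K QB) :
    beta0 HA HB (x * y) = beta0 HA HB x * beta0 HA HB y := by
  refine LinearMap.ext fun ⟨m, n⟩ => ?_
  rw [Module.End.mul_apply, beta0_apply, beta0_apply, beta0_apply, HB.ρmul, eps_mul,
    Module.End.mul_apply, LinearMap.map_smul_of_tower, HA.idem, mul_smul]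

/-- The twisting involution. -/
noncomputable def sig (t : L) : Module.End L (MA × MB) where
  toFun w := (w.1 - HA.f0 w.1 • HA.m0 - HA.f1 w.1 • HA.m1 + (t * HB.f1 w.2) • HA.m0
      + HB.f0 w.2 • HA.m1,
    w.2 - HB.f0 w.2 • HB.m0 - HB.f1 w.2 • HB.m1 + (t⁻¹ * HA.f0 w.1) • HB.m1
      + HA.f1 w.1 • HB.m0)
  map_add' v w := by
    ext1 <;> simp only [Prod.fst_add, Prod.snd_add, map_add, mul_add, add_smul] <;> abel
  map_smul' c w := by
    ext1 <;> simp only [Prod.smul_fst, Prod.smul_snd, map_smul, smul_eq_mul, RingHom.id_apply] <;>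
      module

theorem sig_apply (t : L) (m : MA) (n : MB) : sig HA HB t (m, n) =
    (m - HA.f0 m • HA.m0 - HA.f1 m • HA.m1 + (t * HB.f1 n) • HA.m0 + HB.f0 n • HA.m1,
    n - HB.f0 n • HB.m0 - HB.f1 n • HB.m1 + (t⁻¹ * HA.f0 m) • HB.m1 + HA.f1 m • HB.m0) := rfl

theorem sig_sq {t : L} (ht : t ≠ 0) : sig HA HB t * sig HA HB t = 1 := by
  refine LinearMap.ext fun ⟨m, n⟩ => ?_
  rw [Module.End.mul_apply, sig_apply, sig_apply]
  simp only [map_add, map_sub, map_smul, HA.f00, HA.f01', HA.f10, HA.f11', HB.f00, HB.f01', HB.f10,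
    HB.f11', smul_eq_mul, Module.End.one_apply]
  have h1 : t * t⁻¹ = 1 := mul_inv_cancel₀ ht
  have e1 : ∀ c : L, t * (t⁻¹ * c) = c := fun c => by rw [← mul_assoc, h1, one_mul]
  have e2 : ∀ c : L, t⁻¹ * (t * c) = c := fun c => by rw [← mul_assoc, mul_comm t⁻¹, h1, one_mul]
  ext1
  · simp only [mul_one, mul_zero, sub_self, sub_zero, zero_add, add_zero, e1, zero_sub,
      add_sub_cancel_left]
    module
  · simp only [mul_one, mul_zero, sub_self, sub_zero, zero_add, add_zero, e2, zero_sub,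
      add_sub_cancel_left]
    module

theorem alpha_a_eq : alpha HA HB (ve K a) = beta0 HA HB (ve K b) := by
  refine LinearMap.ext fun ⟨m, n⟩ => ?_
  rw [alpha_apply, beta0_apply]
  unfold ve
  rw [eps_nil, eps_nil, one_smul, one_smul]

theorem sig_comm (t : L) :
    sig HA HB t * beta0 HA HB (ve K b) = beta0 HA HB (ve K b) * sig HA HB t := by
  refine LinearMap.ext fun ⟨m, n⟩ => ?_
  have h : eps K b (ve K b) = 1 := eps_nil b
  rw [Module.End.mul_apply, Module.End.mul_apply, sig_apply, beta0_apply, beta0_apply, sig_apply, h]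
  simp only [one_smul, map_add, map_sub, map_smul, HA.em0', HA.em1, HB.em0', HB.em1, HA.f0e',
    HA.f1e', HB.f0e', HB.f1e']

/-- The twisted action of the other side. -/
noncomputable def beta (t : L) (x : PathAlg K QB) : Module.End L (MA × MB) :=
  sig HA HB t * beta0 HA HB x * sig HA HB t

theorem beta_mul {t : L} (ht : t ≠ 0) (x y : PathAlg K QB) :
    beta HA HB t (x * y) = beta HA HB t x * beta HA HB t y := by
  unfold beta
  rw [beta0_mul]
  calc _ = sig HA HB t * beta0 HA HB x * 1 * beta0 HA HB y * sig HA HB t := by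
        simp only [mul_one, mul_assoc]
    _ = _ := by
        rw [← sig_sq HA HB ht]
        simp only [mul_assoc]

theorem beta_b {t : L} (ht : t ≠ 0) : beta HA HB t (ve K b) = alpha HA HB (ve K a) := by
  unfold beta
  rw [sig_comm, mul_assoc, sig_sq HA HB ht, mul_one, alpha_a_eq]

theorem beta_ne (t : L) {j : QB.V} (h : j ≠ b) :
    beta HA HB t (ve K j) = beta0 HA HB (ve K j) := by
  have h0 : eps K b (ve K j) = 0 := eps_nil_ne h
  refine LinearMap.ext fun ⟨m, n⟩ => ?_
  unfold beta
  rw [Module.End.mul_apply, Module.End.mul_apply, sig_apply, beta0_apply, beta0_apply, sig_apply,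
    h0]
  simp [HB.f_ne h, HB.m_ne h]

theorem alpha_beta_ne (t : L) {j : QB.V} (h : j ≠ b) (i : QA.V) :
    alpha HA HB (ve K i) * beta HA HB t (ve K j) = 0 ∧
    beta HA HB t (ve K j) * alpha HA HB (ve K i) = 0 := by
  have h0 : eps K b (ve K j) = 0 := eps_nil_ne h
  rw [beta_ne HA HB t h]
  constructor
  · refine LinearMap.ext fun ⟨m, n⟩ => ?_
    rw [Module.End.mul_apply, beta0_apply, alpha_apply, h0, HB.orth h.symm]
    simp
  · refine LinearMap.ext fun ⟨m, n⟩ => ?_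
    rw [Module.End.mul_apply, alpha_apply, beta0_apply, h0, LinearMap.map_smul_of_tower, HB.orth h]
    simp

theorem eigen (t : L) :
    beta HA HB t (pathEl K QB q) (alpha HA HB (pathEl K QA p) (HA.m0, 0)) = t • (HA.m0, (0 : MB)) := by
  have e1 : alpha HA HB (pathEl K QA p) (HA.m0, 0) = (HA.m1, 0) := by
    rw [alpha_apply, map_zero, smul_zero]; rfl
  have e2 : sig HA HB t (HA.m1, 0) = (0, HB.m0) := by
    rw [sig_apply]; simp [HA.f01', HA.f11']
  have e3 : beta0 HA HB (pathEl K QB q) (0, HB.m0) = (0, HB.m1) := by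
    rw [beta0_apply, map_zero, smul_zero]; rfl
  have e4 : sig HA HB t (0, HB.m1) = t • (HA.m0, (0 : MB)) := by
    rw [sig_apply]; simp [HB.f01', HB.f11']
  unfold beta
  rw [e1, Module.End.mul_apply, Module.End.mul_apply, e2, e3, e4]

/-- Vertex operators of the glued representation. -/
noncomputable def gFv (t : L) : (glueQ QA QB a b).V → Module.End L (MA × MB) :=
  Sum.elim (fun i => alpha HA HB (ve K i)) (fun j => beta HA HB t (ve K j.1))

/-- Arrow operators of the glued representation. -/
noncomputable def gFa (t : L) : (glueQ QA QB a b).Arr → Module.End L (MA × MB) :=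
  Sum.elim
    (fun e => alpha HA HB (pathEl K QA (Quiver.Hom.toPath (⟨e, rfl, rfl⟩ : QA.s e ⟶ QA.t e))))
    (fun e => beta HA HB t (pathEl K QB (Quiver.Hom.toPath (⟨e, rfl, rfl⟩ : QB.s e ⟶ QB.t e))))

theorem gFv_B {t : L} (ht : t ≠ 0) (j : QB.V) :
    gFv HA HB t (vmapB QA QB a b j) = beta HA HB t (ve K j) := by
  by_cases h : j = b
  · subst h
    rw [vmapB_self, beta_b HA HB ht]
    rfl
  · rw [vmapB_of_ne h]
    rfl

theorem gFv_idem {t : L} (ht : t ≠ 0) (i : (glueQ QA QB a b).V) :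
    gFv HA HB t i * gFv HA HB t i = gFv HA HB t i := by
  rcases i with i | j
  · change alpha HA HB (ve K i) * alpha HA HB (ve K i) = alpha HA HB (ve K i)
    rw [← alpha_mul, ve_idem]
  · change beta HA HB t (ve K j.1) * beta HA HB t (ve K j.1) = beta HA HB t (ve K j.1)
    rw [← beta_mul HA HB ht, ve_idem]

theorem gFv_orth {t : L} (ht : t ≠ 0) (i j : (glueQ QA QB a b).V) (h : i ≠ j) :
    gFv HA HB t i * gFv HA HB t j = 0 := by
  rcases i with i | i <;> rcases j with j | j
  · change alpha HA HB (ve K i) * alpha HA HB (ve K j) = 0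
    rw [← alpha_mul, ve_orth (fun e => h (congrArg Sum.inl e)), map_zero]
  · exact (alpha_beta_ne HA HB t j.2 i).1
  · exact (alpha_beta_ne HA HB t i.2 j).2
  · change beta HA HB t (ve K i.1) * beta HA HB t (ve K j.1) = 0
    rw [← beta_mul HA HB ht, ve_orth (fun e => h (congrArg Sum.inr (Subtype.ext e)))]
    unfold beta
    rw [map_zero, mul_zero, zero_mul]

theorem gFa_t {t : L} (ht : t ≠ 0) (e : (glueQ QA QB a b).Arr) :
    gFv HA HB t ((glueQ QA QB a b).t e) * gFa HA HB t e = gFa HA HB t e := by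
  rcases e with e | e
  · change alpha HA HB (ve K (QA.t e)) * alpha HA HB _ = alpha HA HB _
    rw [← alpha_mul]
    unfold ve
    rw [← pathEl_comp, Quiver.Path.comp_nil]
  · change gFv HA HB t (vmapB QA QB a b (QB.t e)) * beta HA HB t _ = beta HA HB t _
    rw [gFv_B HA HB ht, ← beta_mul HA HB ht]
    unfold ve
    rw [← pathEl_comp, Quiver.Path.comp_nil]

/-- The glued representation. -/
noncomputable def gRep (t : L) : PathAlg K (glueQ QA QB a b) →ₗ[K] Module.End L (MA × MB) :=
  psi fun r => repF (gFv HA HB t) (gFa HA HB t) r.2.2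

theorem gRep_mul {t : L} (ht : t ≠ 0) (x y : PathAlg K (glueQ QA QB a b)) :
    gRep HA HB t (x * y) = gRep HA HB t x * gRep HA HB t y := by
  apply psi_mul
  · intro i j k p q
    exact repF_comp _ _ (gFv_idem HA HB ht) (gFa_t HA HB ht) p q
  · intro i j k l p q h
    exact repF_zero _ _ (gFv_idem HA HB ht) (gFv_orth HA HB ht) (gFa_t HA HB ht) p q h

theorem gRep_A (t : L) {i j : QA.V} (r : Quiver.Path i j) :
    gRep HA HB t (pathEl K _ ((embA QA QB a b).mapPath r)) = alpha HA HB (pathEl K QA r) := by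
  unfold gRep
  rw [psi_pathEl]
  simp only [pI]
  induction r with
  | nil => rfl
  | cons r e ih =>
    rw [Prefunctor.mapPath_cons, repF, ih]
    obtain ⟨e, rfl, rfl⟩ := e
    change alpha HA HB _ * _ = _
    rw [← alpha_mul, ← pathEl_comp]
    rfl

theorem gRep_B {t : L} (ht : t ≠ 0) {i j : QB.V} (r : Quiver.Path i j) :
    gRep HA HB t (pathEl K _ ((embB QA QB a b).mapPath r)) = beta HA HB t (pathEl K QB r) := by
  unfold gRep
  rw [psi_pathEl]
  simp only [pI]
  induction r with
  | nil => exact gFv_B HA HB ht i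
  | cons r e ih =>
    rw [Prefunctor.mapPath_cons, repF, ih]
    obtain ⟨e, rfl, rfl⟩ := e
    change beta HA HB t _ * _ = _
    rw [← beta_mul HA HB ht, ← pathEl_comp]
    rfl

theorem pull_gRep_A (t : L) (x : PathAlg K QA) :
    pull (embA QA QB a b) (gRep HA HB t) x = alpha HA HB x := by
  induction x using pathAlg_induction with
  | h0 => simp
  | hadd x y hx hy => rw [map_add, map_add, hx, hy]
  | hs c x hx => rw [map_smul, map_smul, hx]
  | hp i j p => rw [pull_pathEl, gRep_A]

theorem pull_gRep_B {t : L} (ht : t ≠ 0) (x : PathAlg K QB) :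
    pull (embB QA QB a b) (gRep HA HB t) x = beta HA HB t x := by
  induction x using pathAlg_induction with
  | h0 => simp [beta]
  | hadd x y hx hy =>
    rw [map_add, hx, hy]
    unfold beta
    rw [map_add, mul_add, add_mul]
  | hs c x hx =>
    rw [map_smul, hx]
    unfold beta
    rw [map_smul, mul_smul_comm, smul_mul_assoc]
  | hp i j p => rw [pull_pathEl, gRep_B HA HB ht]

end Infinite

theorem glue_infinite {K L : Type} [Field K] [Field L] [Algebra K L] {QA QB : BQuiver}
    {a : QA.V} {b : QB.V} (RA : Set (PIdx QA →₀ K)) (RB : Set (PIdx QB →₀ K))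
    (admA : IsAdmissible K QA (relIdeal K QA RA))
    (admB : IsAdmissible K QB (relIdeal K QB RB))
    {p : Quiver.Path a a} {q : Quiver.Path b b}
    {MA : Type} [AddCommGroup MA] [Module L MA] [Module K MA] [IsScalarTower K L MA]
    {MB : Type} [AddCommGroup MB] [Module L MB] [Module K MB] [IsScalarTower K L MB]
    (HA : Half K L (relIdeal K QA RA) p MA) (HB : Half K L (relIdeal K QB RB) q MB)
    (t : L) (htr : Transcendental K t)
    (fd : FiniteDimensional K (BQAlgModK K (glueQ QA QB a b) (glueIdeal QA QB a b K RA RB))) :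
    False := by
  have ht : t ≠ 0 := by
    rintro rfl
    exact htr isAlgebraic_zero
  set f := gRep HA HB t with hf
  have fmul : ∀ x y, f (x * y) = f x * f y := gRep_mul HA HB ht
  have fkill : ∀ x ∈ glueIdeal QA QB a b K RA RB, f x = 0 := by
    apply relIdeal_le_ker _ f fmul
    rintro _ (⟨r, hr, rfl⟩ | ⟨r, hr, rfl⟩)
    · have hm : evalPA K QA r ∈ relIdeal K QA RA := TwoSidedIdeal.subset_span ⟨r, hr, rfl⟩
      have h1 := pull_evalPA (embA QA QB a b) f r
      rw [pull_gRep_A] at h1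
      refine h1.symm.trans ?_
      refine LinearMap.ext fun ⟨m, n⟩ => ?_
      rw [alpha_apply, HA.kill _ hm, eps_kills a _ admA _ hm, zero_smul]
      rfl
    · have hm : evalPA K QB r ∈ relIdeal K QB RB := TwoSidedIdeal.subset_span ⟨r, hr, rfl⟩
      have h1 := pull_evalPA (embB QA QB a b) f r
      rw [pull_gRep_B HA HB ht] at h1
      refine h1.symm.trans ?_
      have : beta0 HA HB (evalPA K QB r) = 0 := by
        refine LinearMap.ext fun ⟨m, n⟩ => ?_
        rw [beta0_apply, HB.kill _ hm, eps_kills b _ admB _ hm, zero_smul]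
        rfl
      unfold beta
      rw [this, mul_zero, zero_mul]
  let X : PathAlg K (glueQ QA QB a b) :=
    pathEl K _ ((embB QA QB a b).mapPath q) * pathEl K _ ((embA QA QB a b).mapPath p)
  let w0 : MA × MB := (HA.m0, 0)
  have hX : f X w0 = t • w0 := by
    rw [fmul, hf, gRep_A, gRep_B HA HB ht]
    exact eigen HA HB t
  have hpow : ∀ n : ℕ, f (X ^ n * X) w0 = (t ^ n * t) • w0 := by
    intro n
    induction n with
    | zero => simpa using hX
    | succ n ih =>
      rw [pow_succ', mul_assoc, fmul, Module.End.mul_apply, ih, map_smul, hX, smul_smul]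
      congr 1
      ring
  have hpoly : ∀ c : Polynomial K,
      f (Polynomial.aeval X c * X) w0 = (Polynomial.aeval t c * t) • w0 := by
    intro c
    induction c using Polynomial.induction_on' with
    | add c d hc hd =>
      rw [map_add, map_add, add_mul, add_mul, map_add, LinearMap.add_apply, hc, hd, add_smul]
    | monomial n r =>
      rw [Polynomial.aeval_monomial, Polynomial.aeval_monomial, ← Algebra.smul_def,
        ← Algebra.smul_def, smul_mul_assoc, map_smul, LinearMap.smul_apply, hpow, smul_mul_assoc,
        smul_assoc]
  let S := Submodule.restrictScalars K
    (TwoSidedIdeal.asIdeal (glueIdeal QA QB a b K RA RB))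
  have fd' : Module.Finite K (PathAlg K (glueQ QA QB a b) ⧸ S) := fd
  let g : Polynomial K →ₗ[K] (PathAlg K (glueQ QA QB a b) ⧸ S) :=
    S.mkQ ∘ₗ LinearMap.mulRight K X ∘ₗ (Polynomial.aeval X).toLinearMap
  have hg : ¬ Function.Injective g := fun h =>
    Polynomial.not_finite (R := K) (Module.Finite.of_injective g h)
  rw [← LinearMap.ker_eq_bot, Submodule.eq_bot_iff] at hg
  push Not at hg
  obtain ⟨c, hc, hc0⟩ := hg
  have hcS : Polynomial.aeval X c * X ∈ S := by
    have : S.mkQ (Polynomial.aeval X c * X) = 0 := hc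
    rwa [Submodule.mkQ_apply, Submodule.Quotient.mk_eq_zero] at this
  have h0 := hpoly c
  rw [fkill _ hcS] at h0
  have h1 := congrArg (fun w : MA × MB => HA.f0 w.1) h0
  simp only [LinearMap.zero_apply, Prod.fst_zero, map_zero, Prod.smul_fst, map_smul, w0, HA.f00,
    smul_eq_mul, mul_one] at h1
  have h2 : Polynomial.aeval t c = 0 := by
    rcases mul_eq_zero.1 h1.symm with h | h
    · exact h
    · exact absurd h ht
  exact htr ⟨c, hc0, h2⟩

/-- Let `Λ = KQ/I` be the simple gluing algebra of the bound quiver algebras `A = KQ_A/I_A`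
and `B = KQ_B/I_B`, obtained by identifying `a ∈ Q_A` and `b ∈ Q_B`, with
`I = ⟨I_A, I_B⟩`.  Then `Λ` is finite-dimensional if and only if every non-trivial path in
`Q_A` from `a` to `a` lies in `I_A`, or every non-trivial path in `Q_B` from `b` to `b` lies
in `I_B`. -/
theorem glueAlgebra_finiteDimensional_iff
    (K : Type) [Field K] (QA QB : BQuiver) (a : QA.V) (b : QB.V)
    (RA : Set (PIdx QA →₀ K)) (RB : Set (PIdx QB →₀ K))
    (admA : IsAdmissible K QA (relIdeal K QA RA))
    (admB : IsAdmissible K QB (relIdeal K QB RB))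
    (fdA : FiniteDimensional K (BQAlgModK K QA (relIdeal K QA RA)))
    (fdB : FiniteDimensional K (BQAlgModK K QB (relIdeal K QB RB))) :
    FiniteDimensional K
        (BQAlgModK K (glueQ QA QB a b) (glueIdeal QA QB a b K RA RB)) ↔
      ((∀ p : Quiver.Path a a, p ≠ Quiver.Path.nil → pathEl K QA p ∈ relIdeal K QA RA) ∨
        (∀ p : Quiver.Path b b, p ≠ Quiver.Path.nil → pathEl K QB p ∈ relIdeal K QB RB)) := by
  constructor
  · intro fd
    by_contra hcon
    push Not at hcon
    obtain ⟨⟨p, hp, hpI⟩, q, hq, hqI⟩ := hcon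
    obtain ⟨HA⟩ := exists_half K (RatFunc K) _ admA p hp hpI
    obtain ⟨HB⟩ := exists_half K (RatFunc K) _ admB q hq hqI
    exact glue_infinite RA RB admA admB HA HB RatFunc.X RatFunc.transcendental_X fd
  · exact glue_finite RA RB fdA fdB
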